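/- arXiv:math/9807148 — 2 statements merged into one kernel-verified Lean document; each statement's English description precedes it below -/
import Mathlib

section
/- Let 𝔫 be H-type and let λ : 𝔫 → ℝ be a nonzero linear functional vanishing on 𝔳, with ‖λ‖ its dual norm. Then dim 𝔳 is even, say dim 𝔳 = 2n, and there exists an orthonormal basis X₁,…,X_n, Y₁,…,Y_n of 𝔳 such that λ([X_j, X_k]) = 0 and λ([Y_j, Y_k]) = 0 for all j, k = 1,…,n, and λ([X_j, Y_k]) = δ_{jk}·‖λ‖ for all j, k. -/
open scoped RealInnerProductSpace

noncomputable section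

/-- The centre of a (2-step nilpotent) bracket `B`, i.e. the set of elements whose bracket
with every element vanishes. -/
def bracketCentre {n : Type*} [AddCommGroup n] [Module ℝ n]
    (B : n →ₗ[ℝ] n →ₗ[ℝ] n) : Submodule ℝ n :=
  ⨅ x : n, LinearMap.ker (B.flip x)

/-- A family `e` such that `e` together with `K ∘ e` is orthonormal (for `K` orthogonal). -/
def GoodFam {V : Type*} [NormedAddCommGroup V] [InnerProductSpace ℝ V]
    (K : V →ₗ[ℝ] V) (m : ℕ) (e : Fin m → V) : Prop :=
  (∀ i j, ⟪e i, e j⟫ = if i = j then (1 : ℝ) else 0) ∧ ∀ i j, ⟪K (e i), e j⟫ = 0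

theorem GoodFam.orthonormal {V : Type*} [NormedAddCommGroup V] [InnerProductSpace ℝ V]
    {K : V →ₗ[ℝ] V} (hK : ∀ x, K (K x) = -x) (hs : ∀ x y, ⟪K x, y⟫ = -⟪x, K y⟫)
    {m : ℕ} {e : Fin m → V} (h : GoodFam K m e) :
    Orthonormal ℝ (Sum.elim e (fun i => K (e i))) := by
  rw [orthonormal_iff_ite]
  have h2 : ∀ i j, ⟪e i, K (e j)⟫ = 0 := fun i j => by
    rw [real_inner_comm]; exact h.2 j i
  rintro (i | i) (j | j)
  · simp [h.1]
  · simp [h2]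
  · simp [h.2]
  · simp [hs, hK, h.1]

theorem exists_good_or_basis {V : Type*} [NormedAddCommGroup V] [InnerProductSpace ℝ V]
    [FiniteDimensional ℝ V]
    {K : V →ₗ[ℝ] V} (hK : ∀ x, K (K x) = -x) (hs : ∀ x y, ⟪K x, y⟫ = -⟪x, K y⟫) (k : ℕ) :
    (∃ e, GoodFam K k e) ∨ ∃ m, ∃ b : OrthonormalBasis (Fin m ⊕ Fin m) ℝ V,
      ∀ i, b (Sum.inr i) = K (b (Sum.inl i)) := by
  induction k with
  | zero => exact Or.inl ⟨Fin.elim0, fun i => i.elim0, fun i => i.elim0⟩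
  | succ k ih =>
    rcases ih with ⟨e, he⟩ | h
    · have ho := he.orthonormal hK hs
      by_cases hsp : (Submodule.span ℝ (Set.range (Sum.elim e (fun i => K (e i)))))ᗮ = ⊥
      · right
        refine ⟨k, OrthonormalBasis.mkOfOrthogonalEqBot ho hsp, fun i => ?_⟩
        simp
      · left
        obtain ⟨x, hx, hx0⟩ := Submodule.exists_mem_ne_zero_of_ne_bot hsp
        rw [Submodule.mem_orthogonal] at hx
        have hn : ‖x‖ ≠ 0 := norm_ne_zero_iff.mpr hx0
        have h1 : ∀ i, ⟪e i, x⟫ = 0 := fun i =>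
          hx _ (Submodule.subset_span ⟨Sum.inl i, rfl⟩)
        have h2 : ∀ i, ⟪K (e i), x⟫ = 0 := fun i =>
          hx _ (Submodule.subset_span ⟨Sum.inr i, rfl⟩)
        have h1' : ∀ i, ⟪x, e i⟫ = 0 := fun i => by rw [real_inner_comm]; exact h1 i
        have h2' : ∀ i, ⟪K x, e i⟫ = 0 := fun i => by
          rw [hs, real_inner_comm, h2, neg_zero]
        have h3 : ⟪K x, x⟫ = 0 := by
          have := hs x x
          rw [real_inner_comm (K x) x] at this
          linarith
        refine ⟨Fin.cons (‖x‖⁻¹ • x) e, ?_, ?_⟩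
        · intro i j
          refine Fin.cases ?_ (fun i => ?_) i <;> refine Fin.cases ?_ (fun j => ?_) j
          · simp only [Fin.cons_zero, real_inner_self_eq_norm_sq, if_true, norm_smul,
              norm_inv, norm_norm]
            field_simp
          · simp [inner_smul_left, h1', (Fin.succ_ne_zero j).symm]
          · simp [inner_smul_right, h1]
          · simp [he.1]
        · intro i j
          refine Fin.cases ?_ (fun i => ?_) i <;> refine Fin.cases ?_ (fun j => ?_) j
          · simp [inner_smul_left, inner_smul_right, h3]
          · simp [inner_smul_left, h2']
          · simp [inner_smul_right, h2]
          · simp [he.2]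
    · exact Or.inr h

theorem exists_adapted_basis {V : Type*} [NormedAddCommGroup V] [InnerProductSpace ℝ V]
    [FiniteDimensional ℝ V]
    {K : V →ₗ[ℝ] V} (hK : ∀ x, K (K x) = -x) (hs : ∀ x y, ⟪K x, y⟫ = -⟪x, K y⟫) :
    ∃ m, ∃ b : OrthonormalBasis (Fin m ⊕ Fin m) ℝ V,
      ∀ i, b (Sum.inr i) = K (b (Sum.inl i)) := by
  rcases exists_good_or_basis hK hs (Module.finrank ℝ V + 1) with ⟨e, he⟩ | h
  · have := (he.orthonormal hK hs).linearIndependent.fintype_card_le_finrank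
    simp at this
    omega
  · exact h

/-- If `𝔫` is an H-type Lie algebra (2-step nilpotent, with inner product, with
`J(W)² = −‖W‖²·id` on `𝔳 = 𝔷ᗮ`), and `λ` is a nonzero linear functional vanishing on `𝔳`
(with Riesz representative `Wl`, so that the dual norm of `λ` is `‖Wl‖`), then `dim 𝔳` is
even, say `2m`, and `𝔳` has an orthonormal basis `X₁,…,X_m, Y₁,…,Y_m` with
`λ[X_j, X_k] = 0 = λ[Y_j, Y_k]` and `λ[X_j, Y_k] = δ_{jk}‖λ‖`. -/
theorem htype_symplectic_orthonormal_basis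
    {n : Type*} [NormedAddCommGroup n] [InnerProductSpace ℝ n] [FiniteDimensional ℝ n]
    (B : n →ₗ[ℝ] n →ₗ[ℝ] n)
    (hskew : ∀ x y : n, B x y = - B y x)
    (h2step : ∀ x y z : n, B x (B y z) = 0)
    (J : bracketCentre B → (↥(bracketCentre B)ᗮ →ₗ[ℝ] ↥(bracketCentre B)ᗮ))
    (hJ : ∀ (W : bracketCentre B) (X Y : (bracketCentre B)ᗮ),
      ⟪((J W X : ↥(bracketCentre B)ᗮ) : n), (Y : n)⟫ = ⟪(W : n), B X Y⟫)
    (hH : ∀ W : bracketCentre B,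
      (J W) ∘ₗ (J W) = -(‖(W : n)‖ ^ 2) • (LinearMap.id : ↥(bracketCentre B)ᗮ →ₗ[ℝ] ↥(bracketCentre B)ᗮ))
    (lam : n →ₗ[ℝ] ℝ) (hlam : lam ≠ 0)
    (hlam_v : ∀ x ∈ (bracketCentre B)ᗮ, lam x = 0)
    (Wl : n) (hWl : ∀ x : n, ⟪Wl, x⟫ = lam x) :
    ∃ m : ℕ, Module.finrank ℝ ↥(bracketCentre B)ᗮ = 2 * m ∧
      ∃ bas : OrthonormalBasis (Fin m ⊕ Fin m) ℝ ↥(bracketCentre B)ᗮ,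
        (∀ j k : Fin m, lam (B (bas (Sum.inl j)) (bas (Sum.inl k))) = 0) ∧
        (∀ j k : Fin m, lam (B (bas (Sum.inr j)) (bas (Sum.inr k))) = 0) ∧
        (∀ j k : Fin m, lam (B (bas (Sum.inl j)) (bas (Sum.inr k))) =
          if j = k then ‖Wl‖ else 0) := by
  have hWc : Wl ∈ bracketCentre B := by
    rw [← Submodule.orthogonal_orthogonal (bracketCentre B), Submodule.mem_orthogonal]
    intro u hu
    rw [real_inner_comm, hWl, hlam_v u hu]
  have hW0 : Wl ≠ 0 := by
    rintro rfl
    exact hlam (LinearMap.ext fun x => by rw [← hWl]; simp)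
  have hn : ‖Wl‖ ≠ 0 := norm_ne_zero_iff.mpr hW0
  set W : bracketCentre B := ⟨Wl, hWc⟩ with hW
  have hJl : ∀ X Y : (bracketCentre B)ᗮ, ⟪J W X, Y⟫ = lam (B X Y) := fun X Y => by
    rw [← hWl]; exact hJ W X Y
  have hJJ : ∀ X, J W (J W X) = -(‖Wl‖ ^ 2) • X := fun X =>
    LinearMap.congr_fun (hH W) X
  obtain ⟨m, b, hb⟩ := exists_adapted_basis (K := ‖Wl‖⁻¹ • J W)
    (by
      intro X
      simp only [LinearMap.smul_apply, map_smul, hJJ, smul_smul]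
      rw [← neg_one_smul ℝ X]
      congr 1
      field_simp)
    (by
      intro X Y
      simp only [LinearMap.smul_apply, inner_smul_left, inner_smul_right]
      rw [real_inner_comm (J W Y) X, hJl, hJl, hskew (X : n) Y]
      simp)
  have hl : ∀ X Y : (bracketCentre B)ᗮ, lam (B X Y) = ‖Wl‖ * ⟪(‖Wl‖⁻¹ • J W) X, Y⟫ := by
    intro X Y
    rw [LinearMap.smul_apply, real_inner_smul_left, hJl]
    field_simp
  have ho := orthonormal_iff_ite.mp b.orthonormal
  refine ⟨m, ?_, b, ?_, ?_, ?_⟩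
  · rw [Module.finrank_eq_card_basis b.toBasis]
    simp; ring
  · intro j k
    rw [hl, ← hb, ho]; simp
  · intro j k
    have : lam (B (b (Sum.inr j)) (b (Sum.inr k))) = -lam (B (b (Sum.inr k)) (b (Sum.inr j))) := by
      rw [hskew, map_neg]
    have hKK : (‖Wl‖⁻¹ • J W) (b (Sum.inr j)) = - b (Sum.inl j) := by
      rw [hb]
      simp only [LinearMap.smul_apply, map_smul, hJJ, smul_smul]
      rw [← neg_one_smul ℝ (b (Sum.inl j))]
      congr 1
      field_simp
    rw [hl, hKK, inner_neg_left, ho]; simp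
  · intro j k
    rw [hl, ← hb, ho]; simp
end
end

section
/- Let 1 ≤ i, j ≤ n with i ≠ j, let 0 ≤ p ≤ 2n+1, and let γ ∈ ℤ^n with γ_i ≥ 1 and γ_j ≥ 2. Then U_{ij} maps V^{p,n,γ} into V^{p,n,γ+e_i−e_j} (where e_i denotes the i-th standard basis vector of ℤ^n), and the restriction of U_{ij} to V^{p,n,γ} is a linear isomorphism from V^{p,n,γ} onto V^{p,n,γ+e_i−e_j}. -/
open scoped TensorProduct

noncomputable section

namespace HeisenbergModel

variable (n : ℕ)

/-- Algebraic model of anti-Fock space: the polynomial algebra `ℂ[x_1,…,x_n]`. -/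
abbrev P := MvPolynomial (Fin n) ℂ

/-- The `(2n+1)`-dimensional coefficient space with distinguished basis
`τ^1,…,τ^n, τ^{1̄},…,τ^{n̄}, τ^w`. -/
abbrev Vc := Fin (2 * n + 1) → ℂ

/-- The exterior algebra `Λ = ⋀ V`. -/
abbrev Lam := ExteriorAlgebra ℂ (Vc n)

/-- The space `P_n ⊗ Λ` on which all operators act. -/
abbrev PL := P n ⊗[ℂ] Lam n

/-- Index of the basis vector `τ^j`. -/
def idx1 (j : Fin n) : Fin (2 * n + 1) := ⟨j.1, by omega⟩

/-- Index of the basis vector `τ^{j̄}`. -/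
def idx2 (j : Fin n) : Fin (2 * n + 1) := ⟨n + j.1, by omega⟩

/-- Index of the basis vector `τ^w`. -/
def idxw : Fin (2 * n + 1) := ⟨2 * n, by omega⟩

/-- The distinguished basis vectors of `V`. -/
def tau (i : Fin (2 * n + 1)) : Vc n := Pi.single i 1

/-- The dual-basis functionals on `V`. -/
def dualf (i : Fin (2 * n + 1)) : Module.Dual ℂ (Vc n) := LinearMap.proj i

/-- Annihilation operator `a_j = ∂/∂x_j` on `P_n`. -/
def aOp (j : Fin n) : P n →ₗ[ℂ] P n := (MvPolynomial.pderiv j).toLinearMap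

/-- Creation operator `a_j^* = (multiplication by x_j)` on `P_n`. -/
def aStarOp (j : Fin n) : P n →ₗ[ℂ] P n := LinearMap.mulLeft ℂ (MvPolynomial.X j)

/-- Left exterior multiplication `e(v)` on `Λ`. -/
def eMulV (v : Vc n) : Lam n →ₗ[ℂ] Lam n := LinearMap.mulLeft ℂ (ExteriorAlgebra.ι ℂ v)

/-- Interior multiplication (left contraction) by a dual functional on `Λ`. -/
def iMulF (f : Module.Dual ℂ (Vc n)) : Lam n →ₗ[ℂ] Lam n :=
  CliffordAlgebra.contractLeft (Q := (0 : QuadraticForm ℂ (Vc n))) f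

/-- Lift an operator on `P_n` to `P_n ⊗ Λ` (acting on the first factor). -/
def onP (f : P n →ₗ[ℂ] P n) : PL n →ₗ[ℂ] PL n := LinearMap.rTensor (Lam n) f

/-- Lift an operator on `Λ` to `P_n ⊗ Λ` (acting on the second factor). -/
def onL (f : Lam n →ₗ[ℂ] Lam n) : PL n →ₗ[ℂ] PL n := LinearMap.lTensor (P n) f

/-- `a_j` acting on `P_n ⊗ Λ`. -/
def A (j : Fin n) : PL n →ₗ[ℂ] PL n := onP n (aOp n j)

/-- `a_j^*` acting on `P_n ⊗ Λ`. -/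
def Astar (j : Fin n) : PL n →ₗ[ℂ] PL n := onP n (aStarOp n j)

/-- `e(τ^j)` acting on `P_n ⊗ Λ`. -/
def E1 (j : Fin n) : PL n →ₗ[ℂ] PL n := onL n (eMulV n (tau n (idx1 n j)))

/-- `e(τ^{j̄})` acting on `P_n ⊗ Λ`. -/
def E2 (j : Fin n) : PL n →ₗ[ℂ] PL n := onL n (eMulV n (tau n (idx2 n j)))

/-- `e(τ^w)` acting on `P_n ⊗ Λ`. -/
def Ew : PL n →ₗ[ℂ] PL n := onL n (eMulV n (tau n (idxw n)))

/-- `i(Z_j)` acting on `P_n ⊗ Λ`. -/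
def I1 (j : Fin n) : PL n →ₗ[ℂ] PL n := onL n (iMulF n (dualf n (idx1 n j)))

/-- `i(Z_{j̄})` acting on `P_n ⊗ Λ`. -/
def I2 (j : Fin n) : PL n →ₗ[ℂ] PL n := onL n (iMulF n (dualf n (idx2 n j)))

/-- `i(W)` acting on `P_n ⊗ Λ`. -/
def Iw : PL n →ₗ[ℂ] PL n := onL n (iMulF n (dualf n (idxw n)))

/-- `θ_j(t) = −√(−1)·√t·(e(τ^j) a_j^* + e(τ^{j̄}) a_j) − √(−1)·e(τ^j) e(τ^{j̄}) i(W)`. -/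
def theta (t : ℝ) (j : Fin n) : PL n →ₗ[ℂ] PL n :=
  (-(Complex.I * (Real.sqrt t : ℝ))) • (E1 n j ∘ₗ Astar n j + E2 n j ∘ₗ A n j)
    - Complex.I • (E1 n j ∘ₗ E2 n j ∘ₗ Iw n)

/-- `θ_j^†(t) = √(−1)·√t·(i(Z_j) a_j + i(Z_{j̄}) a_j^*) + √(−1)·e(τ^w) i(Z_{j̄}) i(Z_j)`. -/
def thetaDag (t : ℝ) (j : Fin n) : PL n →ₗ[ℂ] PL n :=
  (Complex.I * (Real.sqrt t : ℝ)) • (I1 n j ∘ₗ A n j + I2 n j ∘ₗ Astar n j)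
    + Complex.I • (Ew n ∘ₗ I2 n j ∘ₗ I1 n j)

/-- `d(t) = Σ_j θ_j(t) − √(−1)·t·e(τ^w)`. -/
def dOp (t : ℝ) : PL n →ₗ[ℂ] PL n :=
  (∑ j : Fin n, theta n t j) - (Complex.I * (t : ℝ)) • Ew n

/-- `U_{jj} = a_j^* a_j − e(τ^j) i(Z_j) + e(τ^{j̄}) i(Z_{j̄})`. -/
def Udiag (j : Fin n) : PL n →ₗ[ℂ] PL n :=
  Astar n j ∘ₗ A n j - E1 n j ∘ₗ I1 n j + E2 n j ∘ₗ I2 n j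

/-- The `(i,j)` transposition operator `U_{ij} = a_i^* a_j − e(τ^j) i(Z_i) + e(τ^{ī}) i(Z_{j̄})`. -/
def Uoff (i j : Fin n) : PL n →ₗ[ℂ] PL n :=
  Astar n i ∘ₗ A n j - E1 n j ∘ₗ I1 n i + E2 n i ∘ₗ I2 n j

/-- The degree-`p` component `Λ^p` of the exterior algebra, as a submodule. -/
def LamP (p : ℕ) : Submodule ℂ (Lam n) :=
  LinearMap.range (ExteriorAlgebra.ι ℂ : Vc n →ₗ[ℂ] Lam n) ^ p

/-- The subspace `P_n ⊗ Λ^p` of `P_n ⊗ Λ`. -/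
def Wp (p : ℕ) : Submodule ℂ (PL n) :=
  LinearMap.range (TensorProduct.map (LinearMap.id : P n →ₗ[ℂ] P n) (LamP n p).subtype)

/-- The simultaneous eigenspace `V^{p,n,γ} = {v ∈ P_n ⊗ Λ^p : U_{jj} v = γ_j v for all j}`. -/
def Vpγ (p : ℕ) (γ : Fin n → ℤ) : Submodule ℂ (PL n) :=
  Wp n p ⊓ ⨅ j : Fin n, Module.End.eigenspace (Udiag n j) ((γ j : ℂ))


/-- Kronecker delta. -/
def dl {κ : Type} [DecidableEq κ] (a b : κ) : ℂ := if a = b then 1 else 0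

/-- `x_a ∂_b` -/
def bo (a b : Fin n) : Module.End ℂ (P n) := aStarOp n a * aOp n b

/-- `e_a i_b` -/
def fe (a b : Fin (2 * n + 1)) : Module.End ℂ (Lam n) :=
  eMulV n (tau n a) * iMulF n (dualf n b)

lemma ccr (a b : Fin n) (x : P n) : aOp n a (aStarOp n b x)
    = aStarOp n b (aOp n a x) + dl a b • x := by
  simp only [aOp, aStarOp, dl, LinearMap.mulLeft_apply, Derivation.coeFn_coe, Derivation.leibniz,
    MvPolynomial.pderiv_X, smul_eq_mul, Pi.single_apply]
  by_cases h : a = b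
  · subst h; simp
  · simp [h, Ne.symm h]

lemma aa (a b : Fin n) (x : P n) : aOp n a (aOp n b x) = aOp n b (aOp n a x) := by
  have h : ⁅(MvPolynomial.pderiv a : Derivation ℂ (P n) (P n)),
      (MvPolynomial.pderiv b : Derivation ℂ (P n) (P n))⁆ = 0 := by
    refine MvPolynomial.derivation_ext fun k => ?_
    simp only [Derivation.commutator_apply, MvPolynomial.pderiv_X, Derivation.zero_apply,
      Pi.single_apply]
    split_ifs <;> simp
  have h2 := congrArg (fun d => d x) h
  simp only [Derivation.commutator_apply, Derivation.zero_apply] at h2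
  exact sub_eq_zero.1 h2

lemma ss (a b : Fin n) (x : P n) :
    aStarOp n a (aStarOp n b x) = aStarOp n b (aStarOp n a x) := by
  simp only [aStarOp, LinearMap.mulLeft_apply]; ring

lemma bo_comm (a b c d : Fin n) :
    bo n a b * bo n c d = bo n c d * bo n a b + dl b c • bo n a d - dl d a • bo n c b := by
  refine LinearMap.ext fun x => ?_
  simp only [bo, Module.End.mul_apply, LinearMap.add_apply, LinearMap.sub_apply,
    LinearMap.smul_apply, ccr, map_add, map_smul]
  rw [aa n b d, ss n a c]
  abel

lemma car (a b : Fin (2 * n + 1)) (x : Lam n) :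
    iMulF n (dualf n a) (eMulV n (tau n b) x)
      = dl a b • x - eMulV n (tau n b) (iMulF n (dualf n a) x) := by
  have h := CliffordAlgebra.contractLeft_ι_mul (Q := (0 : QuadraticForm ℂ (Vc n)))
    (dualf n a) (tau n b) x
  have h2 : dualf n a (tau n b) = dl a b := by
    simp [dualf, tau, dl, Pi.single_apply]
  rw [h2] at h
  exact h

lemma ii (a b : Fin (2 * n + 1)) (x : Lam n) :
    iMulF n (dualf n a) (iMulF n (dualf n b) x)
      = - iMulF n (dualf n b) (iMulF n (dualf n a) x) :=
  CliffordAlgebra.contractLeft_comm (Q := (0 : QuadraticForm ℂ (Vc n))) _ _ x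

lemma i0 (a : Fin (2 * n + 1)) (x : Lam n) :
    iMulF n (dualf n a) (iMulF n (dualf n a) x) = 0 :=
  CliffordAlgebra.contractLeft_contractLeft (Q := (0 : QuadraticForm ℂ (Vc n))) _ x

lemma ee (a b : Fin (2 * n + 1)) (x : Lam n) :
    eMulV n (tau n a) (eMulV n (tau n b) x) = - eMulV n (tau n b) (eMulV n (tau n a) x) := by
  simp only [eMulV, LinearMap.mulLeft_apply, ← mul_assoc, ← neg_mul]
  congr 1
  rw [neg_mul]
  exact eq_neg_of_add_eq_zero_left (ExteriorAlgebra.ι_add_mul_swap (R := ℂ) (tau n a) (tau n b))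

lemma fe_comm (a b c d : Fin (2 * n + 1)) :
    fe n a b * fe n c d = fe n c d * fe n a b + dl b c • fe n a d - dl d a • fe n c b := by
  refine LinearMap.ext fun x => ?_
  simp only [fe, Module.End.mul_apply, LinearMap.add_apply, LinearMap.sub_apply,
    LinearMap.smul_apply, car, map_sub, map_smul]
  rw [ii n b d, ee n a c]
  simp only [map_neg]
  abel

lemma fe_idem (a : Fin (2 * n + 1)) : fe n a a * fe n a a = fe n a a := by
  refine LinearMap.ext fun x => ?_
  simp [fe, Module.End.mul_apply, car, i0, dl]

lemma dl11 (a b : Fin n) : dl (idx1 n a) (idx1 n b) = dl a b := by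
  simp [dl, idx1, Fin.ext_iff]
lemma dl22 (a b : Fin n) : dl (idx2 n a) (idx2 n b) = dl a b := by
  simp [dl, idx2, Fin.ext_iff]
lemma dl12 (a b : Fin n) : dl (idx1 n a) (idx2 n b) = 0 := by
  have := a.2
  simp [dl, idx1, idx2, Fin.ext_iff]; omega
lemma dl21 (a b : Fin n) : dl (idx2 n a) (idx1 n b) = 0 := by
  have := b.2
  simp [dl, idx1, idx2, Fin.ext_iff]; omega

lemma fe_LamP (a b : Fin (2 * n + 1)) (p : ℕ) (x : Lam n) (hx : x ∈ LamP n p) :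
    fe n a b x ∈ LamP n p := by
  induction p generalizing x with
  | zero =>
    simp only [LamP, pow_zero, Submodule.mem_one] at hx
    obtain ⟨y, rfl⟩ := hx
    have : iMulF n (dualf n b) (algebraMap ℂ (Lam n) y) = 0 :=
      CliffordAlgebra.contractLeft_algebraMap _ _ _
    simp [fe, this]
  | succ p ih =>
    simp only [LamP, pow_succ'] at hx
    refine Submodule.mul_induction_on hx ?_ ?_
    · rintro _ ⟨m, rfl⟩ y hy
      have h := CliffordAlgebra.contractLeft_ι_mul (Q := (0 : QuadraticForm ℂ (Vc n)))
        (dualf n b) m y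
      have h' : iMulF n (dualf n b) (ExteriorAlgebra.ι ℂ m * y) = dualf n b m • y
        - ExteriorAlgebra.ι ℂ m * iMulF n (dualf n b) y := h
      have h3 : fe n a b (ExteriorAlgebra.ι ℂ m * y) =
          dualf n b m • (ExteriorAlgebra.ι ℂ (tau n a) * y)
          + ExteriorAlgebra.ι ℂ m * fe n a b y := by
        simp only [fe, Module.End.mul_apply, h', map_sub, map_smul, eMulV,
          LinearMap.mulLeft_apply, ← mul_assoc]
        rw [eq_neg_of_add_eq_zero_left (ExteriorAlgebra.ι_add_mul_swap (tau n a) m)]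
        simp
      rw [h3]
      simp only [LamP, pow_succ']
      exact add_mem (Submodule.smul_mem _ _ (Submodule.mul_mem_mul ⟨_, rfl⟩ hy))
        (Submodule.mul_mem_mul ⟨_, rfl⟩ (ih y hy))
    · intro x y hx hy
      rw [map_add]; exact add_mem hx hy

lemma onL_Wp (f : Module.End ℂ (Lam n)) (p : ℕ) (hf : ∀ x ∈ LamP n p, f x ∈ LamP n p)
    (v : PL n) (hv : v ∈ Wp n p) : onL n f v ∈ Wp n p := by
  obtain ⟨w, rfl⟩ := hv
  induction w using TensorProduct.induction_on with
  | zero => simp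
  | tmul x y =>
    refine ⟨x ⊗ₜ ⟨f y, hf y y.2⟩, ?_⟩
    simp [onL]
  | add x y hx hy => rw [map_add, map_add]; exact add_mem hx hy

lemma onP_Wp (f : Module.End ℂ (P n)) (p : ℕ)
    (v : PL n) (hv : v ∈ Wp n p) : onP n f v ∈ Wp n p := by
  obtain ⟨w, rfl⟩ := hv
  induction w using TensorProduct.induction_on with
  | zero => simp
  | tmul x y =>
    refine ⟨f x ⊗ₜ y, ?_⟩
    simp [onP]
  | add x y hx hy => rw [map_add, map_add]; exact add_mem hx hy

/-- ring hom version of `onP` -/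
def hP : Module.End ℂ (P n) →ₐ[ℂ] Module.End ℂ (PL n) := Module.End.rTensorAlgHom ℂ _ _
/-- ring hom version of `onL` -/
def hL : Module.End ℂ (Lam n) →ₐ[ℂ] Module.End ℂ (PL n) := Module.End.lTensorAlgHom ℂ _ _

lemma hP_apply (f) : hP n f = onP n f := rfl
lemma hL_apply (f) : hL n f = onL n f := rfl

lemma PL_comm (f g) : hP n f * hL n g = hL n g * hP n f := by
  refine TensorProduct.ext' fun x y => ?_
  simp [hP_apply, hL_apply, onP, onL]

/-- fermionic number operator -/
def Kf (k : Fin n) : Module.End ℂ (Lam n) :=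
  fe n (idx2 n k) (idx2 n k) - fe n (idx1 n k) (idx1 n k)

/-- fermionic part of `U_{ij}` -/
def Df (i j : Fin n) : Module.End ℂ (Lam n) :=
  fe n (idx2 n i) (idx2 n j) - fe n (idx1 n j) (idx1 n i)

lemma Udiag_eq (k : Fin n) : Udiag n k = hP n (bo n k k) + hL n (Kf n k) := by
  simp only [bo, Kf, fe, map_sub, map_mul]
  simp only [hP_apply, hL_apply, Udiag, Astar, A, E1, I1, E2, I2, Module.End.mul_eq_comp]
  abel

lemma Uoff_eq (i j : Fin n) : Uoff n i j = hP n (bo n i j) + hL n (Df n i j) := by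
  simp only [bo, Df, fe, map_sub, map_mul]
  simp only [hP_apply, hL_apply, Uoff, Astar, A, E1, I1, E2, I2, Module.End.mul_eq_comp]
  abel

lemma dl_symm {κ : Type} [DecidableEq κ] (a b : κ) : dl a b = dl b a := by
  simp [dl, eq_comm]

lemma bo_w (k i j : Fin n) :
    bo n k k * bo n i j = bo n i j * bo n k k + (dl k i - dl k j) • bo n i j := by
  have e1 : dl k i • bo n k j = dl k i • bo n i j := by
    by_cases h : k = i
    · rw [h]
    · simp only [dl, h, if_false]; rw [zero_smul, zero_smul]
  have e2 : dl j k • bo n i k = dl k j • bo n i j := by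
    rw [dl_symm]
    by_cases h : k = j
    · rw [h]
    · simp only [dl, h, if_false]; rw [zero_smul, zero_smul]
  rw [bo_comm, e1, e2]
  refine LinearMap.ext fun x => ?_
  simp only [LinearMap.add_apply, LinearMap.sub_apply, LinearMap.smul_apply, sub_smul]
  abel

lemma fe1_w (k i j : Fin n) :
    fe n (idx1 n k) (idx1 n k) * fe n (idx1 n i) (idx1 n j) =
      fe n (idx1 n i) (idx1 n j) * fe n (idx1 n k) (idx1 n k)
        + (dl k i - dl k j) • fe n (idx1 n i) (idx1 n j) := by
  have e1 : dl k i • fe n (idx1 n k) (idx1 n j) = dl k i • fe n (idx1 n i) (idx1 n j) := by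
    by_cases h : k = i
    · rw [h]
    · simp only [dl, h, if_false]; rw [zero_smul, zero_smul]
  have e2 : dl j k • fe n (idx1 n i) (idx1 n k) = dl k j • fe n (idx1 n i) (idx1 n j) := by
    rw [dl_symm]
    by_cases h : k = j
    · rw [h]
    · simp only [dl, h, if_false]; rw [zero_smul, zero_smul]
  rw [fe_comm, dl11, dl11, e1, e2]
  refine LinearMap.ext fun x => ?_
  simp only [LinearMap.add_apply, LinearMap.sub_apply, LinearMap.smul_apply, sub_smul]
  abel

lemma fe2_w (k i j : Fin n) :
    fe n (idx2 n k) (idx2 n k) * fe n (idx2 n i) (idx2 n j) =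
      fe n (idx2 n i) (idx2 n j) * fe n (idx2 n k) (idx2 n k)
        + (dl k i - dl k j) • fe n (idx2 n i) (idx2 n j) := by
  have e1 : dl k i • fe n (idx2 n k) (idx2 n j) = dl k i • fe n (idx2 n i) (idx2 n j) := by
    by_cases h : k = i
    · rw [h]
    · simp only [dl, h, if_false]; rw [zero_smul, zero_smul]
  have e2 : dl j k • fe n (idx2 n i) (idx2 n k) = dl k j • fe n (idx2 n i) (idx2 n j) := by
    rw [dl_symm]
    by_cases h : k = j
    · rw [h]
    · simp only [dl, h, if_false]; rw [zero_smul, zero_smul]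
  rw [fe_comm, dl22, dl22, e1, e2]
  refine LinearMap.ext fun x => ?_
  simp only [LinearMap.add_apply, LinearMap.sub_apply, LinearMap.smul_apply, sub_smul]
  abel

lemma fe12 (a b c d : Fin n) :
    fe n (idx1 n a) (idx1 n b) * fe n (idx2 n c) (idx2 n d) =
      fe n (idx2 n c) (idx2 n d) * fe n (idx1 n a) (idx1 n b) := by
  rw [fe_comm, dl12, dl21]; simp

lemma Kf_w (k i j : Fin n) :
    Kf n k * Df n i j = Df n i j * Kf n k + (dl k i - dl k j) • Df n i j := by
  simp only [Kf, Df, mul_sub, sub_mul, fe1_w, fe2_w, fe12]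
  refine LinearMap.ext fun x => ?_
  simp only [LinearMap.add_apply, LinearMap.sub_apply, LinearMap.smul_apply, sub_smul, smul_sub]
  abel

lemma Kf_comm (k l : Fin n) : Kf n k * Kf n l = Kf n l * Kf n k := by
  simp only [Kf, mul_sub, sub_mul, fe1_w n k l l, fe2_w n k l l, fe12, sub_self, zero_smul]
  abel

lemma Kf_cube (k : Fin n) : Kf n k * Kf n k * Kf n k = Kf n k := by
  have h1 := fe_idem n (idx1 n k)
  have h2 := fe_idem n (idx2 n k)
  have h3 := fe12 n k k k k
  simp only [Kf]
  generalize fe n (idx1 n k) (idx1 n k) = x at *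
  generalize fe n (idx2 n k) (idx2 n k) = y at *
  have h4 : y * x * y = y * x := by rw [mul_assoc, h3, ← mul_assoc, h2]
  have h5 : y * x * x = y * x := by rw [mul_assoc, h1]
  simp only [mul_sub, sub_mul, h1, h2, h3, h4, h5]
  abel

/-- inverse of `c - K` when `K^3 = K`. -/
def rr {S : Type*} [Ring S] [Algebra ℂ S] (c : ℂ) (K : S) : S :=
  (1 / c) • 1 + (1 / (c ^ 2 - 1)) • K + (1 / (c * (c ^ 2 - 1))) • (K * K)

lemma rr_mul {S : Type*} [Ring S] [Algebra ℂ S] (c : ℂ) (K : S) (hK : K * K * K = K)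
    (h0 : c ≠ 0) (h1 : c ^ 2 - 1 ≠ 0) : rr c K * (c • 1 - K) = 1 := by
  simp only [rr, mul_sub, add_mul, smul_mul_assoc, mul_smul_comm, one_mul, mul_one, hK]
  match_scalars <;> field_simp <;> ring

/-- raising operators are nilpotent -/
lemma nil {S : Type*} [Ring S] [Algebra ℂ S] (K T : S) (hK : K * K * K = K)
    (h : K * T = T * K + T) : T * T * T = 0 := by
  have hK2 : K * (K * K) = K := by rw [← mul_assoc, hK]
  have a : K * (T * T * T) = T * T * T * (K + 3) := by
    have e1 : K * (T * T * T) = (K * T) * T * T := by noncomm_ring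
    have e2 : T * K * T * T = T * (K * T) * T := by noncomm_ring
    have e3 : T * (T * K) * T = T * T * (K * T) := by noncomm_ring
    rw [e1, h, add_mul, add_mul, e2, h, mul_add, add_mul, e3, h]
    noncomm_ring
  generalize T * T * T = W at *
  have b : W * ((K + 3) * (K + 3) * (K + 3) - (K + 3)) = 0 := by
    have : (K * K * K - K) * W = 0 := by rw [hK]; simp
    rw [← this]
    have e : (K * K * K - K) * W = K * (K * (K * W)) - K * W := by noncomm_ring
    have f : K * (K * (K * W)) = W * (K + 3) * (K + 3) * (K + 3) := by
      rw [a, ← mul_assoc K W, a, mul_assoc W, ← mul_assoc K W, a]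
      simp only [mul_assoc]
    rw [e, f, a]; noncomm_ring
  have c : (K + 3) * (K + 3) * (K + 3) - (K + 3) = (9 : ℂ) • (K * K) + (27 : ℂ) • K
      + (24 : ℂ) • (1 : S) := by
    have h3 : (3 : S) = (3 : ℂ) • (1 : S) := by
      rw [Algebra.smul_def, map_ofNat, mul_one]
    rw [h3]
    simp only [mul_add, add_mul, smul_mul_assoc, mul_smul_comm, one_mul, mul_one, hK, hK2]
    module
  rw [c] at b
  -- inverse of 9K²+27K+24 modulo K³ = K
  have d : ((9 : ℂ) • (K * K) + (27 : ℂ) • K + (24 : ℂ) • (1 : S)) *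
      ((1 / 24 : ℂ) • (1 : S) + (-9 / 120 : ℂ) • K + (1 / 20 : ℂ) • (K * K)) = 1 := by
    simp only [mul_add, add_mul, smul_mul_assoc, mul_smul_comm, one_mul, mul_one, hK, hK2,
      ← mul_assoc]
    match_scalars <;> norm_num
  calc W = W * 1 := by simp
    _ = 0 := by rw [← d, ← mul_assoc, b, zero_mul]

lemma mem_V (p : ℕ) (γ : Fin n → ℤ) (v : PL n) : v ∈ Vpγ n p γ ↔
    v ∈ Wp n p ∧ ∀ k, Udiag n k v = (γ k : ℂ) • v := by
  simp [Vpγ, Submodule.mem_iInf, Module.End.mem_eigenspace_iff]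

lemma hP_mul (f g) : hP n (f * g) = hP n f * hP n g := map_mul _ _ _
lemma hL_mul (f g) : hL n (f * g) = hL n f * hL n g := map_mul _ _ _
lemma hP_add (f g) : hP n (f + g) = hP n f + hP n g := map_add _ _ _
lemma hL_add (f g) : hL n (f + g) = hL n f + hL n g := map_add _ _ _
lemma hL_sub (f g) : hL n (f - g) = hL n f - hL n g :=
  LinearMap.lTensor_sub _ _
lemma hP_smul (c : ℂ) (f) : hP n (c • f) = c • hP n f := map_smul _ _ _
lemma hL_smul (c : ℂ) (f) : hL n (c • f) = c • hL n f := map_smul _ _ _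
lemma hP_one : hP n 1 = 1 := map_one _

lemma map_V (p : ℕ) (γ γ' : Fin n → ℤ) (T : Module.End ℂ (PL n))
    (hW : ∀ v ∈ Wp n p, T v ∈ Wp n p) (c : Fin n → ℂ) (hcc : ∀ k, (γ' k : ℂ) = γ k + c k)
    (hc : ∀ k, Udiag n k * T = T * Udiag n k + c k • T)
    (v : PL n) (hv : v ∈ Vpγ n p γ) : T v ∈ Vpγ n p γ' := by
  rw [mem_V] at hv ⊢
  refine ⟨hW v hv.1, fun k => ?_⟩
  have := LinearMap.congr_fun (hc k) v
  rw [Module.End.mul_apply, LinearMap.add_apply, LinearMap.smul_apply, Module.End.mul_apply,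
    hv.2 k, LinearMap.map_smul, ← add_smul] at this
  rw [this, hcc]

lemma wP (k : Fin n) (T : Module.End ℂ (P n)) (c : ℂ)
    (h : bo n k k * T = T * bo n k k + c • T) :
    Udiag n k * hP n T = hP n T * Udiag n k + c • hP n T := by
  rw [Udiag_eq, add_mul, mul_add, ← PL_comm, ← hP_mul, h, hP_add, hP_mul, hP_smul]
  abel

lemma wL (k : Fin n) (T : Module.End ℂ (Lam n)) (c : ℂ)
    (h : Kf n k * T = T * Kf n k + c • T) :
    Udiag n k * hL n T = hL n T * Udiag n k + c • hL n T := by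
  rw [Udiag_eq, add_mul, mul_add, PL_comm, ← hL_mul, h, hL_add, hL_mul, hL_smul]
  abel

lemma fe_Wp (a b) (p : ℕ) (v : PL n) (hv : v ∈ Wp n p) : hL n (fe n a b) v ∈ Wp n p :=
  onL_Wp n _ p (fe_LamP n a b p) v hv

lemma Kf_Wp (k) (p : ℕ) (v : PL n) (hv : v ∈ Wp n p) : hL n (Kf n k) v ∈ Wp n p := by
  rw [Kf, hL_sub, LinearMap.sub_apply]; exact sub_mem (fe_Wp n _ _ p v hv) (fe_Wp n _ _ p v hv)

lemma Df_Wp (i j) (p : ℕ) (v : PL n) (hv : v ∈ Wp n p) : hL n (Df n i j) v ∈ Wp n p := by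
  rw [Df, hL_sub, LinearMap.sub_apply]; exact sub_mem (fe_Wp n _ _ p v hv) (fe_Wp n _ _ p v hv)

lemma Kf_V (k) (p : ℕ) (γ : Fin n → ℤ) (v : PL n) (hv : v ∈ Vpγ n p γ) :
    hL n (Kf n k) v ∈ Vpγ n p γ := by
  refine map_V n p γ γ _ (Kf_Wp n k p) (fun _ => 0) (fun k => (add_zero _).symm) (fun l => ?_) v hv
  refine wL n l _ 0 ?_
  rw [Kf_comm, zero_smul, add_zero]

lemma bo_mul (i j : Fin n) (hij : i ≠ j) :
    bo n j i * bo n i j = bo n j j * (bo n i i + 1) := by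
  refine LinearMap.ext fun x => ?_
  simp only [bo, Module.End.mul_apply, LinearMap.add_apply, ccr, map_add, map_smul,
    Module.End.one_apply]
  have h : dl j i = 0 := by simp [dl, hij.symm]
  have h' : dl i i = 1 := by simp [dl]
  rw [h, h', aa n j i, zero_smul, one_smul, add_zero]

lemma num_V (p : ℕ) (γ : Fin n → ℤ) (k) (v : PL n) (hv : v ∈ Vpγ n p γ) :
    hP n (bo n k k) v = (γ k : ℂ) • v - hL n (Kf n k) v := by
  have := ((mem_V n p γ v).1 hv).2 k
  rw [Udiag_eq, LinearMap.add_apply] at this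
  exact eq_sub_of_add_eq this

theorem core {X : Type*} [AddCommGroup X] [Module ℂ X] (V V' : Submodule ℂ X)
    (N M D Ki Kj ni nj : Module.End ℂ X) (ci cj : ℂ)
    (hi0 : ci ≠ 0) (hi1 : ci ^ 2 - 1 ≠ 0) (hj0 : cj ≠ 0) (hj1 : cj ^ 2 - 1 ≠ 0)
    (hNV : ∀ v ∈ V, N v ∈ V') (hDV : ∀ v ∈ V, D v ∈ V') (hMV : ∀ v ∈ V', M v ∈ V)
    (hKiV : ∀ v ∈ V, Ki v ∈ V) (hKjV : ∀ v ∈ V, Kj v ∈ V) (hKjV' : ∀ v ∈ V', Kj v ∈ V')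
    (hni : ∀ v ∈ V, ni v = (ci - 1) • v - Ki v) (hnj : ∀ v ∈ V, nj v = cj • v - Kj v)
    (hni' : ∀ v ∈ V', ni v = ci • v - Ki v) (hnj' : ∀ v ∈ V', nj v = (cj - 1) • v - Kj v)
    (hMN : M * N = nj * (ni + 1)) (hNM : N * M = ni * (nj + 1))
    (hKK : Ki * Kj = Kj * Ki) (hNKi : N * Ki = Ki * N) (hNKj : N * Kj = Kj * N)
    (hMKi : M * Ki = Ki * M) (hKi3 : Ki * Ki * Ki = Ki) (hKj3 : Kj * Kj * Kj = Kj)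
    (hKD : Ki * D = D * Ki + D) :
    (∀ v ∈ V, (N + D) v ∈ V') ∧ Submodule.map (N + D) V = V' ∧
      ∀ v ∈ V, (N + D) v = 0 → v = 0 := by
  set R : Module.End ℂ X := rr ci Ki * rr cj Kj with hR
  have hrV : ∀ (c : ℂ) (K : Module.End ℂ X), (∀ v ∈ V, K v ∈ V) → ∀ v ∈ V, rr c K v ∈ V := by
    intro c K hK v hv
    simp only [rr, LinearMap.add_apply, LinearMap.smul_apply, Module.End.one_apply,
      Module.End.mul_apply]
    have h1 := hK v hv
    exact add_mem (add_mem (Submodule.smul_mem _ _ hv) (Submodule.smul_mem _ _ h1))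
      (Submodule.smul_mem _ _ (hK _ h1))
  have hRV : ∀ v ∈ V, R v ∈ V := fun v hv => hrV _ _ hKiV _ (hrV _ _ hKjV _ hv)
  have hri : rr ci Ki * (ci • 1 - Ki) = 1 := rr_mul _ _ hKi3 hi0 hi1
  have hrj : rr cj Kj * (cj • 1 - Kj) = 1 := rr_mul _ _ hKj3 hj0 hj1
  have hRinv : R * ((cj • 1 - Kj) * (ci • 1 - Ki)) = 1 := by
    calc _ = rr ci Ki * (rr cj Kj * (cj • 1 - Kj)) * (ci • 1 - Ki) := by
          simp only [hR, mul_assoc]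
      _ = 1 := by rw [hrj, mul_one, hri]
  have hrc : ∀ (c : ℂ) (K T : Module.End ℂ X), T * K = K * T → T * rr c K = rr c K * T := by
    intro c K T h
    have h2 : T * (K * K) = K * K * T := by rw [← mul_assoc, h, mul_assoc, h, mul_assoc]
    simp only [rr, add_mul, mul_add, smul_mul_assoc, mul_smul_comm, one_mul, mul_one, h, h2]
  have hNR : N * R = R * N := by
    rw [hR, ← mul_assoc, hrc _ _ _ hNKi, mul_assoc, hrc _ _ _ hNKj, mul_assoc]
  have hRKi : R * Ki = Ki * R := by
    rw [hR, ← mul_assoc, hrc _ _ _ rfl, mul_assoc, mul_assoc, hrc _ _ _ hKK]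
  have hMNv : ∀ v ∈ V, R (M (N v)) = v := by
    intro v hv
    have e : M (N v) = ((cj • 1 - Kj) * (ci • 1 - Ki) : Module.End ℂ X) v := by
      rw [← Module.End.mul_apply, hMN]
      simp only [Module.End.mul_apply, LinearMap.add_apply, map_add, map_sub, map_smul,
        LinearMap.sub_apply, LinearMap.smul_apply, Module.End.one_apply, hni v hv, hnj v hv,
        hnj _ (hKiV v hv)]
      module
    rw [e, ← Module.End.mul_apply, hRinv, Module.End.one_apply]
  have hNMv : ∀ v ∈ V', N (R (M v)) = v := by
    intro v hv
    have e : N (M v) = ((cj • 1 - Kj) * (ci • 1 - Ki) : Module.End ℂ X) v := by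
      have hKKv := LinearMap.congr_fun hKK v
      simp only [Module.End.mul_apply] at hKKv
      rw [← Module.End.mul_apply, hNM]
      simp only [Module.End.mul_apply, LinearMap.add_apply, map_add, map_sub, map_smul,
        LinearMap.sub_apply, LinearMap.smul_apply, Module.End.one_apply, hni' v hv, hnj' v hv,
        hni' _ (hKjV' v hv), hKKv]
      module
    rw [← Module.End.mul_apply N, hNR, Module.End.mul_apply, e, ← Module.End.mul_apply, hRinv,
      Module.End.one_apply]
  have hT : (D * (R * M)) * (D * (R * M)) * (D * (R * M)) = 0 := by
    apply nil Ki _ hKi3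
    rw [← mul_assoc, hKD, add_mul, mul_assoc D Ki, ← mul_assoc Ki, ← hRKi, mul_assoc R, ← hMKi]
    simp only [mul_assoc]
  have hT' : ((R * M) * D) * ((R * M) * D) * ((R * M) * D) = 0 := by
    apply nil Ki _ hKi3
    rw [← mul_assoc, ← mul_assoc Ki, ← hRKi, mul_assoc R, ← hMKi, ← mul_assoc, mul_assoc (R * M),
      hKD]
    simp only [mul_assoc, mul_add]
  have hmaps : ∀ v ∈ V, (N + D) v ∈ V' := by
    intro v hv
    rw [LinearMap.add_apply]
    exact add_mem (hNV v hv) (hDV v hv)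
  refine ⟨hmaps, le_antisymm ?_ ?_, ?_⟩
  · rintro _ ⟨v, hv, rfl⟩
    exact hmaps v hv
  · intro v hv
    have hG : ∀ w ∈ V', R (M w) ∈ V := fun w hw => hRV _ (hMV _ hw)
    have hDG : ∀ w ∈ V', D (R (M w)) ∈ V' := fun w hw => hDV _ (hG _ hw)
    have t := LinearMap.congr_fun hT v
    simp only [Module.End.mul_apply, LinearMap.zero_apply] at t
    refine ⟨R (M (v - D (R (M v)) + D (R (M (D (R (M v))))))), ?_, ?_⟩
    · exact hG _ (add_mem (sub_mem hv (hDG _ hv)) (hDG _ (hDG _ hv)))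
    · rw [LinearMap.add_apply,
        hNMv _ (add_mem (sub_mem hv (hDG _ hv)) (hDG _ (hDG _ hv)))]
      simp only [map_add, map_sub, t]
      abel
  · intro v hv h
    rw [LinearMap.add_apply] at h
    have h1 : v = - R (M (D v)) := by
      have := congrArg (fun z => R (M z)) h
      simp only [map_add, hMNv v hv, map_zero] at this
      exact eq_neg_of_add_eq_zero_left this
    have t := LinearMap.congr_fun hT' v
    simp only [Module.End.mul_apply, LinearMap.zero_apply] at t
    have h2 : R (M (D v)) = - v := by rw [eq_neg_iff_add_eq_zero, add_comm, ← eq_neg_iff_add_eq_zero]; exact h1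
    simp only [h2, map_neg, neg_neg] at t
    simpa using t

/-- If `γ_i ≥ 1` and `γ_j ≥ 2` (`i ≠ j`), then `U_{ij}` maps `V^{p,n,γ}` into
`V^{p,n,γ+e_i−e_j}`, and its restriction to `V^{p,n,γ}` is a linear isomorphism onto
`V^{p,n,γ+e_i−e_j}`. -/
theorem Uoff_isomorphism (n : ℕ) (hn : 1 ≤ n) (i j : Fin n) (hij : i ≠ j)
    (p : ℕ) (hp : p ≤ 2 * n + 1) (γ : Fin n → ℤ) (hγi : 1 ≤ γ i) (hγj : 2 ≤ γ j) :
    (∀ v ∈ Vpγ n p γ, Uoff n i j v ∈ Vpγ n p (γ + Pi.single i 1 - Pi.single j 1)) ∧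
    Submodule.map (Uoff n i j) (Vpγ n p γ) = Vpγ n p (γ + Pi.single i 1 - Pi.single j 1) ∧
    (∀ v ∈ Vpγ n p γ, Uoff n i j v = 0 → v = 0) := by
  have hg : ∀ k, (((γ + Pi.single i 1 - Pi.single j 1 : Fin n → ℤ) k : ℤ) : ℂ)
      = γ k + (dl k i - dl k j) := by
    intro k
    simp [dl, Pi.single_apply, add_sub_assoc]
  generalize γ + Pi.single i 1 - Pi.single j 1 = γ' at *
  have hci : (γ' i : ℂ) = γ i + 1 := by rw [hg]; simp [dl, hij]
  have hcj : (γ' j : ℂ) = γ j - 1 := by rw [hg]; simp [dl, hij.symm, sub_eq_add_neg]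
  rw [Uoff_eq]
  refine core (Vpγ n p γ) (Vpγ n p γ') (hP n (bo n i j)) (hP n (bo n j i)) (hL n (Df n i j))
    (hL n (Kf n i)) (hL n (Kf n j)) (hP n (bo n i i)) (hP n (bo n j j)) (γ i + 1) (γ j)
    ?_ ?_ ?_ ?_ ?_ ?_ ?_ (Kf_V n i p γ) (Kf_V n j p γ) (Kf_V n j p γ') ?_ (num_V n p γ j) ?_ ?_
    ?_ ?_ ?_ (PL_comm n _ _) (PL_comm n _ _) (PL_comm n _ _) ?_ ?_ ?_
  · exact_mod_cast (by omega : γ i + 1 ≠ 0)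
  · exact_mod_cast (by nlinarith : (γ i + 1) ^ 2 - 1 ≠ 0)
  · exact_mod_cast (by omega : γ j ≠ 0)
  · exact_mod_cast (by nlinarith : (γ j) ^ 2 - 1 ≠ 0)
  · exact map_V n p γ γ' _ (fun v hv => onP_Wp n _ p v hv) _ hg fun k => wP n k _ _ (bo_w n k i j)
  · exact map_V n p γ γ' _ (Df_Wp n i j p) _ hg fun k => wL n k _ _ (Kf_w n k i j)
  · exact map_V n p γ' γ _ (fun v hv => onP_Wp n _ p v hv) (fun k => dl k j - dl k i)
      (fun k => by rw [hg]; ring) fun k => wP n k _ _ (bo_w n k j i)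
  · intro v hv
    rw [num_V n p γ i v hv, add_sub_cancel_right]
  · intro v hv
    rw [num_V n p γ' i v hv, hci]
  · intro v hv
    rw [num_V n p γ' j v hv, hcj]
  · rw [← hP_mul, bo_mul n i j hij, hP_mul, hP_add, hP_one]
  · rw [← hP_mul, bo_mul n j i hij.symm, hP_mul, hP_add, hP_one]
  · rw [← hL_mul, Kf_comm, hL_mul]
  · rw [← hL_mul, ← hL_mul, Kf_cube]
  · rw [← hL_mul, ← hL_mul, Kf_cube]
  · have h1 : dl i i - dl i j = 1 := by simp [dl, hij]
    rw [← hL_mul, Kf_w, h1, one_smul, hL_add, hL_mul]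

end HeisenbergModel
end
end
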